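/- arXiv:1409.0352 — 2 statements merged into one kernel-verified Lean document; each statement's English description precedes it below -/
import Mathlib

section
/- The Hausdorff γ-measure of the Cantor set 𝒞 equals 1, where γ = log 2 / log 3. -/
/-!
Setting: `𝔽₃((X⁻¹))`, the field of formal Laurent series over the field `𝔽₃` with `3` elements,
with absolute value `|f| = 3^N` when `f = ∑_{n ≥ -N} a_{-n} X^{-n}` with `a_N ≠ 0`, `|0| = 0`.
We model it as `LaurentSeries (ZMod 3)` in the variable `t = X⁻¹`, so the coefficient
`a_{-n}` of `X^{-n}` is the coefficient of `t^n`, and `|f| = 3^{-ord_t f}`.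
-/

noncomputable section
open scoped ENNReal Classical

instance : Fact (Nat.Prime 3) := ⟨by norm_num⟩

/-- The field with three elements. -/
abbrev F3 := ZMod 3

/-- The field `𝔽₃((X⁻¹))`, modelled as Laurent series in `t = X⁻¹`. -/
abbrev L3 := LaurentSeries F3

/-- The element `X`, i.e. `t⁻¹`. -/
def XL : L3 := HahnSeries.single (-1 : ℤ) 1

/-- The absolute value: `|f| = 3^{-ord_t f}` for `f ≠ 0` and `|0| = 0`. -/
def absv (f : L3) : ℝ := if f = 0 then 0 else (3 : ℝ) ^ (-f.order)

/-- The ball of radius `r` around `x` for the ultrametric `d(x, y) = |x - y|`. -/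
def ball (x : L3) (r : ℝ) : Set L3 := {y | absv (y - x) < r}

/-- The unit ball `𝕀 = {h : |h| < 1}` around `0`. -/
def unitBall : Set L3 := ball 0 1

/-- The Cantor set `𝒞`: elements of `𝕀` all of whose coefficients `a_{-n}` lie in `{0, 2}`. -/
def Cantor : Set L3 :=
  {f | (∀ m : ℤ, m ≤ 0 → f.coeff m = 0) ∧ ∀ m : ℤ, 1 ≤ m → f.coeff m = 0 ∨ f.coeff m = 2}

/-- `γ = log 2 / log 3`. -/
def gam : ℝ := Real.log 2 / Real.log 3

/-- The Hausdorff `f`-measure of `A ⊆ 𝔽₃((X⁻¹))`, as defined in the paper: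
`ℋ^f(A) = lim_{ρ → 0} inf ∑ᵢ f(r(Bᵢ))`, the infimum being over countable covers of `A`
by balls `Bᵢ` with radius `r(Bᵢ) ≤ ρ`.  Every ball has radius `3^k` for some `k ∈ ℤ`;
a ball is recorded as a pair (centre, k).  (The `⨆` over `ρ` is the limit `ρ → 0`, the inner
infimum being antitone in `ρ`.) -/
def hmeas (f : ℝ → ℝ) (A : Set L3) : ℝ≥0∞ :=
  ⨆ (ρ : ℝ) (_ : 0 < ρ),
    ⨅ (S : Set (L3 × ℤ)) (_ : S.Countable)
      (_ : ∀ p ∈ S, (3 : ℝ) ^ p.2 ≤ ρ)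
      (_ : A ⊆ ⋃ p ∈ S, ball p.1 ((3 : ℝ) ^ p.2)),
      ∑' p : S, ENNReal.ofReal (f ((3 : ℝ) ^ (p : L3 × ℤ).2))

/-- The Hausdorff `γ`-measure `ℋ^γ`. -/
def hgamma (A : Set L3) : ℝ≥0∞ := hmeas (fun r => r ^ gam) A

/-- `μ(A) = ℋ^γ(A ∩ 𝒞)`. -/
def mu (A : Set L3) : ℝ≥0∞ := hgamma (A ∩ Cantor)

/-- A dimension function: a continuous, non-decreasing `f : ℝ_{≥0} → ℝ_{≥0}` with `f 0 = 0`. -/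
structure IsDimFun (f : ℝ → ℝ) : Prop where
  mono : MonotoneOn f (Set.Ici 0)
  cont : ContinuousOn f (Set.Ici 0)
  zero : f 0 = 0
  nonneg : ∀ r, 0 ≤ r → 0 ≤ f r

/-- The image of a polynomial `g ∈ 𝔽₃[X]` in `𝔽₃((X⁻¹))`. -/
def toL (g : Polynomial F3) : L3 := Polynomial.aeval XL g

/-- `ℱ(N)`: polynomials over `𝔽₃` of degree `< N`, all of whose coefficients
`a_0, …, a_{N-1}` lie in `{0, 2}`. -/
def Fset (N : ℕ) : Set (Polynomial F3) :=
  {g | g.degree < (N : ℕ) ∧ ∀ k < N, g.coeff k = 0 ∨ g.coeff k = 2}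

/-- `ℱ*(N)`: members of `ℱ(N)` with `g(0) = 2`. -/
def FsetStar (N : ℕ) : Set (Polynomial F3) :=
  {g | g.degree < (N : ℕ) ∧ (∀ k < N, g.coeff k = 0 ∨ g.coeff k = 2) ∧ g.coeff 0 = 2}

/-- `W_𝒞(ψ)`: elements `h ∈ 𝒞` with `|h - g/X^N| < ψ(3^N)` for infinitely many `N ∈ ℕ`,
where `g ∈ ℱ(N)`.  Here `ψ N` stands for `ψ(3^N)`. -/
def Wc (ψ : ℕ → ℝ) : Set L3 :=
  {h ∈ Cantor | ∀ m : ℕ, ∃ N : ℕ, m ≤ N ∧ 1 ≤ N ∧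
    ∃ g ∈ Fset N, absv (h - toL g / XL ^ N) < ψ N}

/-- `W*_𝒞(ψ)`: defined like `W_𝒞(ψ)`, with `ℱ*(N)` in place of `ℱ(N)`. -/
def WcStar (ψ : ℕ → ℝ) : Set L3 :=
  {h ∈ Cantor | ∀ m : ℕ, ∃ N : ℕ, m ≤ N ∧ 1 ≤ N ∧
    ∃ g ∈ FsetStar N, absv (h - toL g / XL ^ N) < ψ N}

/-- `A*_n = ⋃_{g ∈ ℱ*(n)} B(g/Xⁿ, ψ(3ⁿ))`. -/
def Astar (ψ : ℕ → ℝ) (n : ℕ) : Set L3 :=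
  ⋃ g ∈ FsetStar n, ball (toL g / XL ^ n) (ψ n)

/-- `𝒦(ψ)`: elements `ξ ∈ 𝕀` with `|ξ - g/h| < ψ(|h|)` for infinitely many fractions
`g/h ∈ 𝔽₃(X)`.  Here `ψ d` stands for `ψ(3^d)`, and `|h| = 3^{deg h}`. -/
def Kset (ψ : ℕ → ℝ) : Set L3 :=
  {ξ ∈ unitBall | {gh : Polynomial F3 × Polynomial F3 | gh.2 ≠ 0 ∧
    absv (ξ - toL gh.1 / toL gh.2) < ψ gh.2.natDegree}.Infinite}

/-- The irrationality exponent
`τ(ξ) = sup {τ : |ξ - g/h| < |h|^{-τ} for infinitely many g/h ∈ 𝔽₃(X)}`, valued in `[0, ∞]`. -/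
def irrExp (ξ : L3) : ℝ≥0∞ :=
  sSup {t : ℝ≥0∞ | ∃ τ : ℝ, t = ENNReal.ofReal τ ∧
    {gh : Polynomial F3 × Polynomial F3 | gh.2 ≠ 0 ∧
      absv (ξ - toL gh.1 / toL gh.2) < absv (toL gh.2) ^ (-τ)}.Infinite}

theorem three_zpow_rpow_gam (k : ℤ) :
    ENNReal.ofReal (((3 : ℝ) ^ k) ^ gam) = (2 : ℝ≥0∞) ^ k := by
  have h3 : (3 : ℝ) ^ gam = 2 := by
    rw [gam, Real.rpow_def_of_pos (by norm_num),
      mul_div_cancel₀ _ (Real.log_pos (by norm_num)).ne', Real.exp_log (by norm_num)]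
  rw [← Real.rpow_intCast, ← Real.rpow_mul (by norm_num), mul_comm,
    Real.rpow_mul (by norm_num), h3, Real.rpow_intCast]
  obtain ⟨n, rfl | rfl⟩ := k.eq_nat_or_neg
  · rw [zpow_natCast, zpow_natCast, ENNReal.ofReal_pow (by norm_num), ENNReal.ofReal_ofNat]
  · rw [zpow_neg, ENNReal.zpow_neg, zpow_natCast, zpow_natCast,
      ENNReal.ofReal_inv_of_pos (by positivity), ENNReal.ofReal_pow (by norm_num),
      ENNReal.ofReal_ofNat]

theorem mem_ball_zpow_iff {x y : L3} {k : ℤ} :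
    y ∈ ball x ((3 : ℝ) ^ k) ↔ ∀ m ≤ -k, y.coeff m = x.coeff m := by
  simp only [ball, absv, Set.mem_ofPred_eq]
  split_ifs with h
  · rw [sub_eq_zero.mp h]
    simpa using zpow_pos (by norm_num : (0 : ℝ) < 3) k
  · rw [zpow_lt_zpow_iff_right₀ (by norm_num), neg_lt, ← Int.add_one_le_iff,
      HahnSeries.le_order_iff_forall h]
    simp [sub_eq_zero]

/-- The Cantor series whose `n`-th coefficient, `n ≥ 1`, is `2` exactly when `s (n - 1)`. -/
def cantorSeries (s : ℕ → Bool) : L3 :=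
  HahnSeries.ofSuppBddBelow
    (fun m : ℤ => if 1 ≤ m ∧ s (m - 1).toNat = true then (2 : F3) else 0)
    ⟨1, fun m hm => by
      by_contra h
      exact hm (if_neg fun h' => h h'.1)⟩

theorem coeff_cantorSeries (s : ℕ → Bool) (m : ℤ) :
    (cantorSeries s).coeff m = if 1 ≤ m ∧ s (m - 1).toNat = true then 2 else 0 := rfl

theorem F3.two_ne_zero : (2 : F3) ≠ 0 := by decide

theorem cantorSeries_mem (s : ℕ → Bool) : cantorSeries s ∈ Cantor := by
  refine ⟨fun m hm => ?_, fun m _ => ?_⟩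
  · rw [coeff_cantorSeries, if_neg (by omega)]
  · rw [coeff_cantorSeries]
    split_ifs <;> simp

theorem cantorSeries_coeff_eq_iff (s t : ℕ → Bool) (i : ℕ) :
    (cantorSeries s).coeff (i + 1) = (cantorSeries t).coeff (i + 1) ↔ s i = t i := by
  have h : (1 : ℤ) ≤ i + 1 := by omega
  cases hs : s i <;> cases ht : t i <;>
    simp [coeff_cantorSeries, hs, ht, F3.two_ne_zero, F3.two_ne_zero.symm]

theorem hgamma_cantor_le_one : hgamma Cantor ≤ 1 := by
  refine iSup₂_le fun ρ hρ => ?_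
  obtain ⟨n, hn⟩ := exists_pow_lt_of_lt_one hρ (by norm_num : (1 / 3 : ℝ) < 1)
  let extend (t : Fin n → Bool) (i : ℕ) : Bool := if h : i < n then t ⟨i, h⟩ else false
  let c (t : Fin n → Bool) : L3 × ℤ := (cantorSeries (extend t), -n)
  have hc : ∀ p ∈ Set.range c, p.2 = -n := by
    rintro _ ⟨t, rfl⟩
    rfl
  refine iInf_le_of_le (Set.range c) <| iInf_le_of_le (Set.countable_range c) <|
    iInf_le_of_le ?_ <| iInf_le_of_le ?_ ?_
  · intro p hp
    rw [hc p hp, zpow_neg, zpow_natCast, ← inv_pow, ← one_div]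
    exact hn.le
  · intro h hh
    let t : Fin n → Bool := fun i => decide (h.coeff (i + 1) = 2)
    refine Set.mem_biUnion (Set.mem_range_self t) (mem_ball_zpow_iff.mpr fun m hm => ?_)
    change h.coeff m = (cantorSeries (extend t)).coeff m
    replace hm : m ≤ n := by simpa [c] using hm
    rcases le_or_gt m 0 with h0 | h0
    · rw [hh.1 m h0, (cantorSeries_mem _).1 m h0]
    · obtain ⟨i, rfl⟩ : ∃ i : ℕ, m = i + 1 := ⟨(m - 1).toNat, by omega⟩
      have hi : i < n := by omega
      rcases hh.2 _ h0 with h2 | h2 <;>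
        simp [coeff_cantorSeries, extend, t, hi, h2, F3.two_ne_zero.symm]
  · calc ∑' p : Set.range c, ENNReal.ofReal (((3 : ℝ) ^ (p : L3 × ℤ).2) ^ gam)
        = ∑' _ : Set.range c, (2 : ℝ≥0∞) ^ (-n : ℤ) :=
          tsum_congr fun p => by rw [hc p p.2, three_zpow_rpow_gam]
      _ ≤ ∑' _ : Fin n → Bool, (2 : ℝ≥0∞) ^ (-n : ℤ) :=
          ENNReal.tsum_le_tsum_comp_of_surjective Set.rangeFactorization_surjective
            fun _ => (2 : ℝ≥0∞) ^ (-n : ℤ)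
      _ = 1 := by
          rw [tsum_fintype, Finset.sum_const, Finset.card_univ, Fintype.card_fun,
            Fintype.card_bool, Fintype.card_fin, nsmul_eq_mul, ENNReal.zpow_neg, zpow_natCast]
          push_cast
          exact ENNReal.mul_inv_cancel (by simp) (by simp)

/-- The law of a sequence of independent fair coin tosses. -/
def coinMeasure : MeasureTheory.Measure (ℕ → Bool) :=
  MeasureTheory.Measure.infinitePi fun _ => (PMF.uniformOfFintype Bool).toMeasure

instance : MeasureTheory.IsProbabilityMeasure coinMeasure := by
  unfold coinMeasure
  infer_instance

theorem coinMeasure_prefix (s : ℕ → Bool) (n : ℕ) :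
    coinMeasure {t | ∀ i < n, t i = s i} = (2 : ℝ≥0∞) ^ (-n : ℤ) := by
  have h : {t : ℕ → Bool | ∀ i < n, t i = s i} =
      Set.pi (Finset.range n : Set ℕ) fun i => {s i} := by
    ext t
    simp
  rw [h, coinMeasure, MeasureTheory.Measure.infinitePi_pi _ fun _ _ => MeasurableSet.singleton _]
  simp [ENNReal.zpow_neg, ENNReal.inv_pow]

theorem coinMeasure_preimage_ball_le (x : L3) (k : ℤ) :
    coinMeasure (cantorSeries ⁻¹' ball x ((3 : ℝ) ^ k)) ≤ (2 : ℝ≥0∞) ^ k := by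
  rcases le_total 0 k with hk | hk
  · lift k to ℕ using hk
    rw [zpow_natCast (2 : ℝ≥0∞)]
    exact MeasureTheory.prob_le_one.trans (one_le_pow₀ one_le_two)
  · obtain ⟨n, rfl⟩ : ∃ n : ℕ, k = -n := ⟨(-k).toNat, by omega⟩
    rcases (cantorSeries ⁻¹' ball x ((3 : ℝ) ^ (-n : ℤ))).eq_empty_or_nonempty with h | ⟨s, hs⟩
    · rw [h, MeasureTheory.measure_empty]
      exact zero_le
    · refine (MeasureTheory.measure_mono fun t ht i hi => ?_).trans (coinMeasure_prefix s n).le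
      have hm : (i + 1 : ℤ) ≤ -(-n) := by omega
      exact (cantorSeries_coeff_eq_iff t s i).mp <|
        (mem_ball_zpow_iff.mp ht _ hm).trans (mem_ball_zpow_iff.mp hs _ hm).symm

theorem one_le_hgamma_cantor : 1 ≤ hgamma Cantor := by
  refine le_iSup₂_of_le (1 : ℝ) one_pos ?_
  refine le_iInf fun S => le_iInf fun hS => le_iInf fun _ => le_iInf fun hcov => ?_
  calc (1 : ℝ≥0∞) = coinMeasure Set.univ := MeasureTheory.measure_univ.symm
    _ ≤ coinMeasure (⋃ p ∈ S, cantorSeries ⁻¹' ball p.1 ((3 : ℝ) ^ p.2)) :=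
        MeasureTheory.measure_mono fun s _ => by simpa using hcov (cantorSeries_mem s)
    _ ≤ ∑' p : S, coinMeasure (cantorSeries ⁻¹' ball p.1.1 ((3 : ℝ) ^ p.1.2)) :=
        MeasureTheory.measure_biUnion_le _ hS _
    _ ≤ ∑' p : S, ENNReal.ofReal (((3 : ℝ) ^ (p : L3 × ℤ).2) ^ gam) :=
        ENNReal.tsum_le_tsum fun p => by
          rw [three_zpow_rpow_gam]
          exact coinMeasure_preimage_ball_le _ _

/-- The Hausdorff `γ`-measure of the Cantor set `𝒞` equals `1`,
where `γ = log 2 / log 3`. -/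
theorem hgamma_cantor : hgamma Cantor = 1 := by
  exact le_antisymm hgamma_cantor_le_one one_le_hgamma_cantor
end
end

section
/- Let f be a dimension function such that r ↦ r^{-γ} f(r) is monotonic, and suppose ∑_{n=1}^∞ f(ψ(3^n)) · (3^n)^γ = ∞. Then ℋ^f(W_𝒞(ψ)) = ℋ^f(𝒞). -/
/-!
Setting: `𝔽₃((X⁻¹))`, the field of formal Laurent series over the field `𝔽₃` with `3` elements,
with absolute value `|f| = 3^N` when `f = ∑_{n ≥ -N} a_{-n} X^{-n}` with `a_N ≠ 0`, `|0| = 0`.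
We model it as `LaurentSeries (ZMod 3)` in the variable `t = X⁻¹`, so the coefficient
`a_{-n}` of `X^{-n}` is the coefficient of `t^n`, and `|f| = 3^{-ord_t f}`.
-/

noncomputable section
open scoped ENNReal Classical

/-! ### Cylinders of binary sequences -/

/-- The set of binary sequences that agree with `x` in the first `n` places. -/
def cyl (x : ℕ → Bool) (n : ℕ) : Set (ℕ → Bool) := {y | ∀ i < n, y i = x i}

theorem cyl_anti (x : ℕ → Bool) {m n : ℕ} (h : m ≤ n) : cyl x n ⊆ cyl x m :=
  fun _ hy i hi => hy i (hi.trans_le h)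

theorem self_mem_cyl (x : ℕ → Bool) (n : ℕ) : x ∈ cyl x n := fun _ _ => rfl

theorem mem_cyl_symm {x y : ℕ → Bool} {n : ℕ} (h : y ∈ cyl x n) : x ∈ cyl y n :=
  fun i hi => (h i hi).symm

theorem mem_cyl_trans {x y z : ℕ → Bool} {n : ℕ} (h : x ∈ cyl y n) (h' : y ∈ cyl z n) :
    x ∈ cyl z n :=
  fun i hi => (h i hi).trans (h' i hi)

theorem isOpen_cyl (x : ℕ → Bool) (n : ℕ) : IsOpen (cyl x n) :=
  PiNat.isOpen_cylinder (E := fun _ : ℕ => Bool) x n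

theorem measurableSet_cyl (x : ℕ → Bool) (n : ℕ) : MeasurableSet (cyl x n) :=
  (isOpen_cyl x n).measurableSet

/-- There is a fair coin-tossing measure on binary sequences. -/
theorem exists_coin_measure : ∃ μ : MeasureTheory.Measure (ℕ → Bool),
    MeasureTheory.IsProbabilityMeasure μ ∧ ∀ x n, μ (cyl x n) = (2 ^ n)⁻¹ := by
  refine ⟨MeasureTheory.Measure.infinitePi fun _ => (PMF.uniformOfFintype Bool).toMeasure,
    inferInstance, fun x n => ?_⟩
  have : cyl x n = (↑(Finset.range n) : Set ℕ).pi fun i => {x i} := by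
    ext y
    simp [cyl, Set.mem_pi]
  rw [this, MeasureTheory.Measure.infinitePi_pi _ fun _ _ => measurableSet_singleton _]
  simp [ENNReal.inv_pow]

/-- A double-counting inequality: if every point of `E n` collects at least `c n` from the weights
`w i` of the sets `R n i` containing it, and each `i` is used for a single `n` only, and then on at
most one cylinder of length `a n`, then `∑ 2 ^ a n * c n * μ (E n) ≤ ∑ w i`. -/
theorem tsum_mul_measure_le {ι : Type*} [Countable ι] {μ : MeasureTheory.Measure (ℕ → Bool)}
    (hμ : ∀ x n, μ (cyl x n) = (2 ^ n)⁻¹) (w : ι → ℝ≥0∞) (E : ℕ → Set (ℕ → Bool))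
    (R : ℕ → ι → Set (ℕ → Bool)) (hR : ∀ n i, MeasurableSet (R n i)) (a : ℕ → ℕ) (c : ℕ → ℝ≥0∞)
    (hc : ∀ n, ∀ x ∈ E n, c n ≤ ∑' i, (R n i).indicator (fun _ => w i) x)
    (hcyl : ∀ i n, ∃ y, E n ∩ R n i ⊆ cyl y (a n))
    (huniq : ∀ i n n' x x', x ∈ E n ∩ R n i → x' ∈ E n' ∩ R n' i → n ≤ n') :
    ∑' n, 2 ^ a n * (c n * μ (E n)) ≤ ∑' i, w i := by
  have hone : ∀ i, ∑' n, 2 ^ a n * μ (E n ∩ R n i) ≤ 1 := by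
    intro i
    have hle : ∀ n, 2 ^ a n * μ (E n ∩ R n i) ≤ 1 := by
      intro n
      obtain ⟨y, hy⟩ := hcyl i n
      calc 2 ^ a n * μ (E n ∩ R n i) ≤ 2 ^ a n * (2 ^ a n)⁻¹ := by
            gcongr
            exact (MeasureTheory.measure_mono hy).trans_eq (hμ y _)
        _ = 1 := ENNReal.mul_inv_cancel (by simp) (by simp)
    by_cases h : ∃ n, (E n ∩ R n i).Nonempty
    · obtain ⟨n, x, hx⟩ := h
      rw [tsum_eq_single n]
      · exact hle n
      · intro n' hn'
        have : E n' ∩ R n' i = ∅ := by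
          by_contra hne
          obtain ⟨x', hx'⟩ := Set.nonempty_iff_ne_empty.2 hne
          exact hn' (le_antisymm (huniq i _ _ _ _ hx' hx) (huniq i _ _ _ _ hx hx'))
        simp [this]
    · push Not at h
      simp [h]
  calc ∑' n, 2 ^ a n * (c n * μ (E n))
      ≤ ∑' n, 2 ^ a n * ∑' i, w i * μ (E n ∩ R n i) := by
        gcongr with n
        calc c n * μ (E n) = ∫⁻ _ in E n, c n ∂μ := by simp
          _ ≤ ∫⁻ x in E n, ∑' i, (R n i).indicator (fun _ => w i) x ∂μ :=
            MeasureTheory.setLIntegral_mono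
              (Measurable.tsum fun i => measurable_const.indicator (hR n i)) (hc n)
          _ = ∑' i, w i * μ (E n ∩ R n i) := by
            rw [MeasureTheory.lintegral_tsum fun i =>
              (measurable_const.indicator (hR n i)).aemeasurable]
            simp_rw [MeasureTheory.lintegral_indicator_const (hR n _),
              MeasureTheory.Measure.restrict_apply (hR n _), Set.inter_comm]
    _ = ∑' i, w i * ∑' n, 2 ^ a n * μ (E n ∩ R n i) := by
        simp_rw [← ENNReal.tsum_mul_left]
        rw [ENNReal.tsum_comm]
        simp_rw [mul_left_comm]
    _ ≤ ∑' i, w i := by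
        gcongr with i
        exact mul_le_of_le_one_right' (hone i)

/-- The total weight of those cylinders `cyl (s i) (lev i)` that meet `cyl x l`, a cylinder of
length `k` having weight `φ k`. -/
def load {ι : Type*} (φ : ℕ → ℝ≥0∞) (s : ι → ℕ → Bool) (lev : ι → ℕ) (x : ℕ → Bool) (l : ℕ) :
    ℝ≥0∞ :=
  ∑' i, (cyl (s i) (min (lev i) l)).indicator (fun _ => φ (lev i)) x

section Load

variable {ι : Type*} (φ : ℕ → ℝ≥0∞) (s : ι → ℕ → Bool) (lev : ι → ℕ)

theorem load_congr {x y : ℕ → Bool} {l : ℕ} (h : y ∈ cyl x l) :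
    load φ s lev y l = load φ s lev x l := by
  refine tsum_congr fun i => ?_
  have hy := cyl_anti x (min_le_right (lev i) l) h
  by_cases hx : x ∈ cyl (s i) (min (lev i) l)
  · rw [Set.indicator_of_mem hx, Set.indicator_of_mem (mem_cyl_trans hy hx)]
  · rw [Set.indicator_of_notMem hx,
      Set.indicator_of_notMem fun hy' => hx (mem_cyl_trans (mem_cyl_symm hy) hy')]

theorem load_le_tsum (x : ℕ → Bool) (l : ℕ) : load φ s lev x l ≤ ∑' i, φ (lev i) :=
  ENNReal.tsum_le_tsum fun _ => Set.indicator_apply_le fun _ => le_rfl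

theorem le_load {x : ℕ → Bool} {l : ℕ} {i : ι} (h : x ∈ cyl (s i) (lev i)) :
    φ (lev i) ≤ load φ s lev x l := by
  refine le_trans ?_ (ENNReal.le_tsum i)
  rw [Set.indicator_of_mem (cyl_anti _ (min_le_left _ _) h)]

/-- The sequences none of whose cylinders are overloaded have positive measure in `cyl x₀ q`,
provided the total load is below `φ q`. -/
theorem exists_unloaded_of_tsum_lt [Countable ι] {μ : MeasureTheory.Measure (ℕ → Bool)}
    (hμ : ∀ x n, μ (cyl x n) = (2 ^ n)⁻¹) (hanti : Antitone φ)
    (hmono : Monotone fun l => 2 ^ l * φ l) (x₀ : ℕ → Bool) (q : ℕ)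
    (hsum : ∑' i, φ (lev i) < φ q) :
    ∃ E ⊆ cyl x₀ q, μ E ≠ 0 ∧ ∀ x ∈ E, ∀ l, load φ s lev x l < φ l := by
  set B : ℕ → Set (ℕ → Bool) := fun l =>
    {x | x ∈ cyl x₀ q ∧ φ l ≤ load φ s lev x l ∧ ∀ k < l, load φ s lev x k < φ k} with hB
  have hpos : 0 < φ q := bot_le.trans_lt hsum
  have hBq : ∀ l, ∀ x ∈ B l, q ≤ l := by
    intro l x hx
    by_contra hlt
    exact (hx.2.1.trans (load_le_tsum φ s lev x l)).not_gt
      (hsum.trans_le (hanti (not_le.1 hlt).le))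
  have hlev : ∀ i l x, x ∈ B l → x ∈ cyl (s i) (min (lev i) l) → l ≤ lev i := by
    intro i l x hx hxi
    by_contra hlt
    push Not at hlt
    rw [min_eq_left hlt.le] at hxi
    exact (hx.2.2 _ hlt).not_ge (le_load φ s lev hxi)
  have hcharge := tsum_mul_measure_le hμ (fun i => φ (lev i)) B
    (fun l i => cyl (s i) (min (lev i) l)) (fun l i => measurableSet_cyl _ _) id φ
    (fun l x hx => hx.2.1)
    (fun i l => by
      refine ⟨s i, fun x hx => ?_⟩
      have := hlev i l x hx.1 hx.2
      simpa [min_eq_right this] using hx.2)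
    (fun i l l' x x' hx hx' => by
      by_contra hlt
      push Not at hlt
      have h1 := hlev i l x hx.1 hx.2
      have h1' := hx.2
      have h2' := hx'.2
      simp only [min_eq_right h1, min_eq_right (hlt.le.trans h1)] at h1' h2'
      have hmem : x ∈ cyl x' l' :=
        mem_cyl_trans (cyl_anti _ hlt.le h1') (mem_cyl_symm h2')
      have := hx.1.2.2 l' hlt
      rw [load_congr φ s lev hmem] at this
      exact this.not_ge hx'.1.2.1)
  have hlow : 2 ^ q * φ q * ∑' l, μ (B l) ≤ ∑' i, φ (lev i) := by
    refine le_trans ?_ hcharge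
    rw [← ENNReal.tsum_mul_left]
    refine ENNReal.tsum_le_tsum fun l => ?_
    rcases (B l).eq_empty_or_nonempty with h | ⟨x, hx⟩
    · simp [h]
    · rw [← mul_assoc]
      gcongr ?_ * _
      exact hmono (hBq l x hx)
  have hlt : μ (⋃ l, B l) < μ (cyl x₀ q) := by
    by_contra hle
    push Not at hle
    have h1 : 2 ^ q * φ q * (2 ^ q)⁻¹ ≤ ∑' i, φ (lev i) := by
      refine le_trans ?_ hlow
      gcongr
      rw [← hμ x₀ q]
      exact hle.trans (MeasureTheory.measure_iUnion_le _)
    rw [mul_right_comm, ENNReal.mul_inv_cancel (by simp) (by simp), one_mul] at h1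
    exact h1.not_gt hsum
  refine ⟨cyl x₀ q \ ⋃ l, B l, Set.sdiff_subset, fun h0 => ?_, ?_⟩
  · refine hlt.not_ge ?_
    calc μ (cyl x₀ q) ≤ μ ((cyl x₀ q \ ⋃ l, B l) ∪ ⋃ l, B l) :=
          MeasureTheory.measure_mono (by simp)
      _ ≤ μ (cyl x₀ q \ ⋃ l, B l) + μ (⋃ l, B l) := MeasureTheory.measure_union_le _ _
      _ = μ (⋃ l, B l) := by rw [h0, zero_add]
  · intro x hx l
    induction l using Nat.strong_induction_on with
    | _ l ih =>
      by_contra hl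
      exact hx.2 (Set.mem_iUnion.2 ⟨l, hx.1, not_lt.1 hl, ih⟩)

/-- Replace the entries of `x` from place `n` on by `true, false, false, …`. -/
def markEnd (n : ℕ) (x : ℕ → Bool) : ℕ → Bool := fun j => if j < n then x j else decide (j = n)

theorem markEnd_mem_cyl (n : ℕ) (x : ℕ → Bool) : markEnd n x ∈ cyl x n := fun i hi => by
  simp [markEnd, hi]

theorem measurable_markEnd (n : ℕ) : Measurable (markEnd n) := by
  refine measurable_pi_iff.2 fun j => ?_
  by_cases h : j < n
  · simpa [markEnd, h] using measurable_pi_apply j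
  · simp [markEnd, h]

/-- If the total load is below `φ q`, some marked word `markEnd n x` starting in `cyl x₀ q` is not
overloaded at length `r n`: otherwise, by divergence, the marked words would use up more than the
total load. -/
theorem exists_load_markEnd_lt [Countable ι] (hanti : Antitone φ)
    (hmono : Monotone fun l => 2 ^ l * φ l) {r : ℕ → ℕ} {M : ℕ}
    (hr : ∀ n, M ≤ n → n < r n) (hdiv : ∑' n, 2 ^ (n + M) * φ (r (n + M)) = ⊤)
    {x₀ : ℕ → Bool} {q : ℕ} (hsum : ∑' i, φ (lev i) < φ q) :
    ∃ n ≥ M, ∃ x ∈ cyl x₀ q, load φ s lev (markEnd n x) (r n) < φ (r n) := by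
  by_contra! hcon
  obtain ⟨μ, _, hμ⟩ := exists_coin_measure
  obtain ⟨E, hE, hE0, hload⟩ :=
    exists_unloaded_of_tsum_lt φ s lev hμ hanti hmono x₀ q hsum
  have hlev : ∀ i n x, x ∈ E → markEnd (n + M) x ∈ cyl (s i) (min (lev i) (r (n + M))) →
      n + M < lev i := by
    intro i n x hx hxi
    by_contra! hle
    rw [min_eq_left (hle.trans (hr _ (by omega)).le)] at hxi
    exact (hload x hx (lev i)).not_ge (le_load φ s lev (mem_cyl_trans
      (mem_cyl_symm (cyl_anti _ hle (markEnd_mem_cyl _ x))) hxi))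
  have hcharge := tsum_mul_measure_le hμ (fun i => φ (lev i)) (fun _ => E)
    (fun n i => markEnd (n + M) ⁻¹' cyl (s i) (min (lev i) (r (n + M))))
    (fun n i => measurable_markEnd _ (measurableSet_cyl _ _)) (fun n => n + M)
    (fun n => φ (r (n + M)))
    (fun n x hx => hcon (n + M) (by omega) x (hE hx))
    (fun i n => by
      refine ⟨s i, fun x hx => ?_⟩
      have h1 := hlev i n x hx.1 hx.2
      have h2 := hr (n + M) (by omega)
      exact mem_cyl_trans (mem_cyl_symm (markEnd_mem_cyl _ x))
        (cyl_anti _ (le_min h1.le h2.le) hx.2))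
    (fun i n n' x x' hx hx' => by
      by_contra! hlt
      have h1 := hlev i n x hx.1 hx.2
      have h2 := hr (n + M) (by omega)
      have hs : s i (n + M) = true := by
        rw [← hx.2 (n + M) (lt_min h1 h2)]
        simp [markEnd]
      rcases lt_or_ge (n + M) (r (n' + M)) with h3 | h3
      · have := hx'.2 (n + M) (lt_min h1 h3)
        rw [hs] at this
        simp [markEnd, hlt.not_gt, hlt.ne'] at this
      · have h4 : x ∈ cyl (markEnd (n' + M) x') (r (n' + M)) := by
          refine mem_cyl_trans (mem_cyl_symm (cyl_anti _ h3 (markEnd_mem_cyl _ x))) ?_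
          refine mem_cyl_trans (cyl_anti _ (le_min ?_ ?_) hx.2)
            (mem_cyl_symm (cyl_anti _ (le_min ?_ le_rfl) hx'.2)) <;> omega
        have h5 := hload x hx.1 (r (n' + M))
        rw [load_congr φ s lev h4] at h5
        exact h5.not_ge (hcon (n' + M) (by omega) x' (hE hx'.1)))
  simp_rw [← mul_assoc, ENNReal.tsum_mul_right, hdiv, ENNReal.top_mul hE0] at hcharge
  exact (hcharge.trans_lt hsum).ne_top rfl

theorem exists_extension_load_lt [Countable ι] (hanti : Antitone φ)
    (hmono : Monotone fun l => 2 ^ l * φ l) {r : ℕ → ℕ} {M : ℕ}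
    (hr : ∀ n, M ≤ n → n < r n) (hdiv : ∑' n, 2 ^ (n + M) * φ (r (n + M)) = ⊤)
    {x₀ : ℕ → Bool} {q : ℕ} (hq : q ≤ M) (hload : load φ s lev x₀ q < φ q) :
    ∃ n ≥ M, ∃ y ∈ cyl x₀ q, (∀ j, n < j → j < r n → y j = false) ∧
      load φ s lev y (r n) < φ (r n) := by
  set T : Set ι := {i | x₀ ∈ cyl (s i) (min (lev i) q)} with hT
  have hTload : ∑' i : T, φ (lev i) = load φ s lev x₀ q := by
    rw [tsum_subtype T fun i => φ (lev i)]
    rfl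
  obtain ⟨n, hn, x, hx, hlt⟩ := exists_load_markEnd_lt φ (fun i : T => s i) (fun i : T => lev i)
    hanti hmono hr hdiv (x₀ := x₀) (hTload.trans_lt hload)
  have hy : markEnd n x ∈ cyl x₀ q :=
    mem_cyl_trans (cyl_anti _ (hq.trans hn) (markEnd_mem_cyl n x)) hx
  refine ⟨n, hn, markEnd n x, hy, fun j hj _ => ?_, ?_⟩
  · simp [markEnd, hj.not_gt, hj.ne']
  · convert hlt using 1
    unfold load
    rw [tsum_subtype T fun i => (cyl (s i) (min (lev i) (r n))).indicator
      (fun _ => φ (lev i)) (markEnd n x)]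
    refine tsum_congr fun i => ?_
    by_cases hi : i ∈ T
    · rw [Set.indicator_of_mem hi]
    · rw [Set.indicator_of_notMem hi, Set.indicator_of_notMem]
      intro hmem
      have hqr : q ≤ r n := by have := hr n hn; omega
      exact hi (mem_cyl_trans (mem_cyl_symm (cyl_anti _ (min_le_right _ _) hy))
        (cyl_anti _ (min_le_min_left _ hqr) hmem))

theorem exists_load_lt [Countable ι] (r₀ : ℕ) (hsum : ∑' i, φ (lev i) < 2 ^ r₀ * φ r₀)
    (hlev : ∀ i, r₀ ≤ lev i) : ∃ x, load φ s lev x r₀ < φ r₀ := by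
  by_contra! hcon
  obtain ⟨μ, _, hμ⟩ := exists_coin_measure
  have hcharge := tsum_mul_measure_le hμ (fun i => φ (lev i))
    (fun n => if n = 0 then Set.univ else ∅)
    (fun _ i => cyl (s i) (min (lev i) r₀)) (fun _ i => measurableSet_cyl _ _) (fun _ => r₀)
    (fun _ => φ r₀) (fun n x _ => hcon x)
    (fun i n => ⟨s i, fun x hx => by simpa [min_eq_right (hlev i)] using hx.2⟩)
    (fun i n n' x x' hx hx' => by
      by_cases h : n = 0
      · omega
      · simp [h] at hx)
  rw [tsum_eq_single 0 fun n hn => by simp [hn]] at hcharge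
  simp only [if_true, MeasureTheory.measure_univ, mul_one] at hcharge
  exact hcharge.not_gt hsum

/-- A countable family of cylinders of length at least `r₀` with total weight below
`2 ^ r₀ * φ r₀` misses a sequence that, for infinitely many `n`, vanishes strictly between the
places `n` and `r n`. -/
theorem exists_limsup_notMem_cyl [Countable ι] (hanti : Antitone φ)
    (hmono : Monotone fun l => 2 ^ l * φ l) (hfin : ∀ l, φ l ≠ ⊤) {r : ℕ → ℕ} {m₀ : ℕ}
    (hr : ∀ n, m₀ ≤ n → n < r n) (hdiv : ∑' n, 2 ^ n * φ (r n) = ⊤)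
    (r₀ : ℕ) (hlev : ∀ i, r₀ ≤ lev i) (hsum : ∑' i, φ (lev i) < 2 ^ r₀ * φ r₀) :
    ∃ x, (∀ i, x ∉ cyl (s i) (lev i)) ∧
      ∀ m, ∃ n ≥ m, ∀ j, n < j → j < r n → x j = false := by
  have htail : ∀ M, ∑' n, 2 ^ (n + M) * φ (r (n + M)) = ⊤ := by
    intro M
    by_contra hne
    rw [← ENNReal.summable.sum_add_tsum_nat_add' (k := M)] at hdiv
    refine ENNReal.add_ne_top.2 ⟨?_, hne⟩ hdiv
    exact ENNReal.sum_ne_top.2 fun n _ => ENNReal.mul_ne_top (by simp) (hfin _)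
  obtain ⟨x₀, hx₀⟩ := exists_load_lt φ s lev r₀ hsum hlev
  have hstep : ∀ k : ℕ, ∀ p : {p : (ℕ → Bool) × ℕ // load φ s lev p.1 p.2 < φ p.2},
      ∃ p' : {p : (ℕ → Bool) × ℕ // load φ s lev p.1 p.2 < φ p.2},
        p'.1.1 ∈ cyl p.1.1 p.1.2 ∧ p.1.2 < p'.1.2 ∧
        ∃ n ≥ k, p'.1.2 = r n ∧ ∀ j, n < j → j < r n → p'.1.1 j = false := by
    rintro k ⟨⟨x, q⟩, hp⟩
    obtain ⟨n, hn, y, hy, hzero, hload⟩ := exists_extension_load_lt φ s lev hanti hmono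
      (M := max (max m₀ q) k) (fun n hn => hr n (by omega)) (htail _) (by omega) hp
    refine ⟨⟨(y, r n), hload⟩, hy, ?_, n, by omega, rfl, hzero⟩
    have := hr n (by omega)
    change q < r n
    omega
  choose next hnext using hstep
  let p : ℕ → {p : (ℕ → Bool) × ℕ // load φ s lev p.1 p.2 < φ p.2} :=
    fun k => Nat.rec ⟨(x₀, r₀), hx₀⟩ (fun k p => next k p) k
  have hp : ∀ k, p (k + 1) = next k (p k) := fun _ => rfl
  set y : ℕ → ℕ → Bool := fun k => (p k).1.1 with hy
  set l : ℕ → ℕ := fun k => (p k).1.2 with hl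
  have hmem : ∀ k, y (k + 1) ∈ cyl (y k) (l k) := fun k => (hnext k (p k)).1
  have hlt : StrictMono l := strictMono_nat_of_lt_succ fun k => (hnext k (p k)).2.1
  have hchain : ∀ k d, y (k + d) ∈ cyl (y k) (l k) := by
    intro k d
    induction d with
    | zero => exact self_mem_cyl _ _
    | succ d ih => exact mem_cyl_trans (cyl_anti _ (hlt.monotone (by omega)) (hmem (k + d))) ih
  have hx : ∀ k, (fun j => y (j + 1) j) ∈ cyl (y k) (l k) := by
    intro k j hj
    rcases le_total k (j + 1) with h | h
    · obtain ⟨d, hd⟩ := Nat.exists_eq_add_of_le h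
      change y (j + 1) j = y k j
      rw [hd]
      exact hchain k d j hj
    · obtain ⟨d, hd⟩ := Nat.exists_eq_add_of_le h
      have := hchain (j + 1) d j ((Nat.lt_succ_self j).trans_le (hlt.id_le (j + 1)))
      rw [← hd] at this
      exact this.symm
  refine ⟨fun j => y (j + 1) j, fun i hi => ?_, fun m => ?_⟩
  · have h1 : lev i ≤ l (lev i) := hlt.id_le _
    have h2 : y (lev i) ∈ cyl (s i) (lev i) :=
      mem_cyl_trans (mem_cyl_symm (cyl_anti _ h1 (hx (lev i)))) hi
    exact ((p (lev i)).2.trans_le (hanti h1)).not_ge (le_load φ s lev h2)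
  · obtain ⟨-, -, n, hn, hrn, hzero⟩ := hnext m (p m)
    refine ⟨n, hn, fun j hj hjr => ?_⟩
    rw [← hzero j hj hjr]
    exact hx (m + 1) j (hjr.trans_eq hrn.symm)

end Load

/-! ### Laurent series with coefficients in `{0, 2}` -/

theorem absv_lt_iff (z : L3) (r : ℤ) : absv z < (3 : ℝ) ^ (-r) ↔ ∀ m ≤ r, z.coeff m = 0 := by
  by_cases hz : z = 0
  · simp only [hz, absv, if_true, HahnSeries.coeff_zero, implies_true, iff_true]
    positivity
  · rw [absv, if_neg hz, zpow_lt_zpow_iff_right₀ (by norm_num), neg_lt_neg_iff,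
      Int.lt_iff_add_one_le, HahnSeries.le_order_iff_forall hz]
    exact ⟨fun h m hm => h m (by omega), fun h m hm => h m (by omega)⟩

theorem mem_ball_iff (x y : L3) (k : ℤ) :
    y ∈ ball x ((3 : ℝ) ^ k) ↔ ∀ m ≤ -k, y.coeff m = x.coeff m := by
  have := absv_lt_iff (y - x) (-k)
  rw [neg_neg] at this
  simp only [ball, Set.mem_ofPred_eq, this, HahnSeries.coeff_sub, sub_eq_zero]

theorem XL_pow (n : ℕ) : XL ^ n = HahnSeries.single (-(n : ℤ)) (1 : F3) := by
  simp [XL, HahnSeries.single_pow]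

theorem coeff_toL (g : Polynomial F3) (m : ℤ) :
    (toL g).coeff m = if m ≤ 0 then g.coeff (-m).toNat else 0 := by
  induction g using Polynomial.induction_on' with
  | add p q hp hq =>
    have : toL (p + q) = toL p + toL q := map_add _ p q
    rw [this, HahnSeries.coeff_add, hp, hq]
    split_ifs <;> simp
  | monomial n a =>
    have : toL (Polynomial.monomial n a) = HahnSeries.single (-(n : ℤ)) a := by
      have hC : algebraMap F3 L3 = HahnSeries.C := RingHom.ext_zmod _ _
      rw [toL, Polynomial.aeval_monomial, XL_pow, hC, HahnSeries.C_apply]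
      simp
    rw [this, HahnSeries.coeff_single, Polynomial.coeff_monomial]
    split_ifs <;> first | rfl | omega

theorem coeff_toL_div (g : Polynomial F3) (N : ℕ) (m : ℤ) :
    (toL g / XL ^ N).coeff m = if m ≤ N then g.coeff (N - m).toNat else 0 := by
  have h1 : (XL ^ N)⁻¹ = HahnSeries.single (N : ℤ) (1 : F3) := by
    rw [XL_pow]
    refine inv_eq_of_mul_eq_one_right ?_
    simp
  have h2 := HahnSeries.coeff_single_mul_add (r := (1 : F3)) (x := toL g) (a := m - N) (b := (N : ℤ))
  rw [div_eq_mul_inv, h1, mul_comm]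
  rw [sub_add_cancel, one_mul] at h2
  rw [h2, coeff_toL]
  simp

theorem exists_mem_Fset {c : L3} (hc : c ∈ Cantor) (N : ℕ) :
    ∃ g ∈ Fset N, ∀ m : ℤ, (toL g / XL ^ N).coeff m = if m ≤ N then c.coeff m else 0 := by
  set g : Polynomial F3 :=
    ∑ k ∈ Finset.range N, Polynomial.monomial k (c.coeff ((N : ℤ) - k)) with hg
  have hcoeff : ∀ k, g.coeff k = if k < N then c.coeff ((N : ℤ) - k) else 0 := by
    intro k
    simp [hg, Polynomial.coeff_monomial]
  refine ⟨g, ⟨?_, fun k hk => ?_⟩, fun m => ?_⟩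
  · rw [Polynomial.degree_lt_iff_coeff_zero]
    intro k hk
    simp [hcoeff, hk]
  · rw [hcoeff, if_pos hk]
    exact hc.2 _ (by omega)
  · rw [coeff_toL_div]
    split_ifs with hm
    · rw [hcoeff]
      split_ifs with h
      · congr 1
        omega
      · exact (hc.1 m (by omega)).symm
    · rfl

/-- The element of the Cantor set with digits prescribed by a binary sequence. -/
def ofBits (x : ℕ → Bool) : L3 :=
  HahnSeries.ofSuppBddBelow (fun m : ℤ => if 1 ≤ m ∧ x (m - 1).toNat then (2 : F3) else 0)
    ⟨1, fun m hm => by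
      by_contra h
      simp [h] at hm⟩

theorem coeff_ofBits (x : ℕ → Bool) (m : ℤ) :
    (ofBits x).coeff m = if 1 ≤ m ∧ x (m - 1).toNat then 2 else 0 := rfl

theorem ofBits_mem_Cantor (x : ℕ → Bool) : ofBits x ∈ Cantor := by
  refine ⟨fun m hm => ?_, fun m _ => ?_⟩
  · simp [coeff_ofBits, show ¬1 ≤ m by omega]
  · rw [coeff_ofBits]
    split_ifs <;> simp

theorem coeff_ofBits_eq_iff {x y : ℕ → Bool} (j : ℕ) :
    (ofBits x).coeff (j + 1) = (ofBits y).coeff (j + 1) ↔ x j = y j := by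
  have h2 : (2 : F3) ≠ 0 := by decide
  have h1 : (1 : ℤ) ≤ j + 1 := by omega
  simp only [coeff_ofBits, h1, true_and, add_sub_cancel_right, Int.toNat_natCast]
  cases x j <;> cases y j <;> simp [h2, h2.symm]

theorem mem_Wc_of_coeff_eq_zero {ψ : ℕ → ℝ} {R : ℕ → ℤ}
    (hR : ∀ n, ψ (n + 1) = (3 : ℝ) ^ (-R n)) {c : L3} (hc : c ∈ Cantor)
    (h : ∀ m : ℕ, ∃ n ≥ m, ∀ j : ℤ, (n : ℤ) + 1 < j → j ≤ R n → c.coeff j = 0) :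
    c ∈ Wc ψ := by
  refine ⟨hc, fun m => ?_⟩
  obtain ⟨n, hn, hzero⟩ := h m
  obtain ⟨g, hg, hcoeff⟩ := exists_mem_Fset hc (n + 1)
  refine ⟨n + 1, by omega, by omega, g, hg, ?_⟩
  rw [hR, absv_lt_iff]
  intro j hj
  rw [HahnSeries.coeff_sub, hcoeff]
  split_ifs with hjn
  · exact sub_self _
  · rw [hzero j (by push_cast at hjn; omega) hj, sub_zero]

/-! ### Hausdorff measures of subsets of the Cantor set -/

theorem hmeas_mono (f : ℝ → ℝ) {A B : Set L3} (h : A ⊆ B) : hmeas f A ≤ hmeas f B := by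
  refine iSup₂_mono fun ρ hρ => iInf₂_mono fun S hS => iInf_mono fun hsmall => ?_
  exact le_iInf fun hcov => iInf_le_of_le (h.trans hcov) le_rfl

theorem exists_forall_three_zpow_le (ρ : ℝ) (hρ : 0 < ρ) :
    ∃ r₀ : ℕ, ∀ r ≥ r₀, (3 : ℝ) ^ (-(r : ℤ)) ≤ ρ := by
  obtain ⟨r₀, hr₀⟩ := exists_pow_lt_of_lt_one hρ (show (3⁻¹ : ℝ) < 1 by norm_num)
  refine ⟨r₀, fun r hr => le_trans ?_ hr₀.le⟩
  rw [zpow_neg, zpow_natCast, ← inv_pow]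
  exact pow_le_pow_of_le_one (by norm_num) (by norm_num) hr

theorem hmeas_Cantor_le (f : ℝ → ℝ) (b : ℝ≥0∞)
    (h : ∀ r₀ : ℕ, ∃ r ≥ r₀, 2 ^ r * ENNReal.ofReal (f ((3 : ℝ) ^ (-(r : ℤ)))) ≤ b) :
    hmeas f Cantor ≤ b := by
  refine iSup₂_le fun ρ hρ => ?_
  obtain ⟨r₀, hr₀⟩ := exists_forall_three_zpow_le ρ hρ
  obtain ⟨r, hr, hb⟩ := h r₀
  set e : (Fin r → Bool) → L3 × ℤ :=
    fun w => (ofBits fun j => if hj : j < r then w ⟨j, hj⟩ else false, -(r : ℤ)) with he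
  refine iInf₂_le_of_le (Set.range e) (Set.countable_range e) ?_
  refine iInf_le_of_le ?_ (iInf_le_of_le ?_ (le_trans ?_ hb))
  · rintro _ ⟨w, rfl⟩
    exact hr₀ r hr
  · intro c hc
    refine Set.mem_iUnion₂.2 ⟨_, ⟨fun i => decide (c.coeff (i + 1) = 2), rfl⟩, ?_⟩
    rw [mem_ball_iff]
    intro m hm
    have hmr : m ≤ r := by simpa [he] using hm
    rw [coeff_ofBits]
    by_cases h1 : 1 ≤ m
    · have h2 : (m - 1).toNat < r := by omega
      have h3 : ((m - 1).toNat : ℤ) + 1 = m := by omega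
      have h4 : (0 : F3) ≠ 2 := by decide
      simp only [h1, h2, h3, true_and, dite_true, decide_eq_true_eq]
      rcases hc.2 m h1 with h | h <;> simp [h, h4]
    · simp [h1, hc.1 m (by omega)]
  · refine le_trans (ENNReal.tsum_le_tsum_comp_of_surjective Set.rangeFactorization_surjective _) ?_
    simp [he]

theorem le_hmeas_Wc {f : ℝ → ℝ} {ψ : ℕ → ℝ} {R : ℕ → ℤ}
    (hR : ∀ n, ψ (n + 1) = (3 : ℝ) ^ (-R n)) {m₀ : ℕ} (hm₀ : ∀ n, m₀ ≤ n → (n : ℤ) + 1 < R n)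
    {φ : ℕ → ℝ≥0∞} (hle : ∀ l : ℕ, φ l ≤ ENNReal.ofReal (f ((3 : ℝ) ^ (-(l : ℤ)))))
    (hanti : Antitone φ) (hmono : Monotone fun l => 2 ^ l * φ l)
    (hdiv : ∑' n, 2 ^ n * φ (R n).toNat = ⊤) (r₀ : ℕ) :
    2 ^ r₀ * φ r₀ ≤ hmeas f (Wc ψ) := by
  refine le_iSup₂_of_le ((3 : ℝ) ^ (-(r₀ : ℤ))) (by positivity) ?_
  refine le_iInf₂ fun S hS => le_iInf₂ fun hsmall hcov => ?_
  by_contra! hlt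
  have := hS.to_subtype
  have hk : ∀ p ∈ S, p.2 ≤ -(r₀ : ℤ) := fun p hp =>
    (zpow_le_zpow_iff_right₀ (by norm_num)).1 (hsmall p hp)
  have hlev : ∀ p : S, r₀ ≤ (-p.1.2).toNat := fun p => by
    have := hk p p.2
    omega
  have hpick : ∀ p : S, ∃ s : ℕ → Bool, ∀ x : ℕ → Bool,
      ofBits x ∈ ball p.1.1 ((3 : ℝ) ^ p.1.2) → x ∈ cyl s (-p.1.2).toNat := by
    intro p
    by_cases h : ∃ s, ofBits s ∈ ball p.1.1 ((3 : ℝ) ^ p.1.2)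
    · obtain ⟨s, hs⟩ := h
      refine ⟨s, fun x hx j hj => ?_⟩
      rw [mem_ball_iff] at hs hx
      rw [← coeff_ofBits_eq_iff, hx _ (by omega), hs _ (by omega)]
    · push Not at h
      exact ⟨fun _ => false, fun x hx => absurd hx (h x)⟩
  choose s hs using hpick
  obtain ⟨x, hx, hxW⟩ := exists_limsup_notMem_cyl φ s (fun p : S => (-p.1.2).toNat) hanti hmono
    (fun l => ((hle l).trans_lt ENNReal.ofReal_lt_top).ne) (r := fun n => (R n).toNat) (m₀ := m₀)
    (fun n hn => by have := hm₀ n hn; omega) hdiv r₀ hlev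
    (by
      refine lt_of_le_of_lt (ENNReal.tsum_le_tsum fun p => (hle _).trans_eq ?_) hlt
      have := hk p p.2
      rw [show -((-p.1.2).toNat : ℤ) = p.1.2 by omega])
  have hmem : ofBits x ∈ Wc ψ := by
    refine mem_Wc_of_coeff_eq_zero hR (ofBits_mem_Cantor x) fun m => ?_
    obtain ⟨n, hn, hzero⟩ := hxW m
    refine ⟨n, hn, fun j hj hjR => ?_⟩
    rw [coeff_ofBits, hzero (j - 1).toNat (by omega) (by omega)]
    simp
  obtain ⟨p, hp, hball⟩ := Set.mem_iUnion₂.1 (hcov hmem)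
  exact hx ⟨p, hp⟩ (hs ⟨p, hp⟩ x hball)

theorem three_rpow_gam : (3 : ℝ) ^ gam = 2 := by
  rw [Real.rpow_def_of_pos (by norm_num), gam, mul_div_cancel₀ _ (Real.log_pos (by norm_num)).ne',
    Real.exp_log (by norm_num)]

theorem three_pow_rpow_gam (n : ℕ) : ((3 : ℝ) ^ n) ^ gam = 2 ^ n := by
  rw [← Real.rpow_natCast, ← Real.rpow_mul (by norm_num), mul_comm, Real.rpow_mul (by norm_num),
    three_rpow_gam, Real.rpow_natCast]

theorem ofReal_three_zpow_rpow_mul (f : ℝ → ℝ) (l : ℕ) :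
    ENNReal.ofReal (((3 : ℝ) ^ (-(l : ℤ))) ^ (-gam) * f ((3 : ℝ) ^ (-(l : ℤ)))) =
      2 ^ l * ENNReal.ofReal (f ((3 : ℝ) ^ (-(l : ℤ)))) := by
  rw [Real.rpow_neg (by positivity), zpow_neg, Real.inv_rpow (by positivity), inv_inv, zpow_natCast,
    three_pow_rpow_gam, ENNReal.ofReal_mul (by positivity), ENNReal.ofReal_pow (by norm_num),
    ENNReal.ofReal_ofNat]

theorem antitone_three_zpow_neg : Antitone fun l : ℕ => (3 : ℝ) ^ (-(l : ℤ)) :=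
  fun _ _ h => zpow_le_zpow_right₀ (by norm_num) (by omega)

/-- divergence case of the Khintchine-type theorem.
If `f` is a dimension function with `r ↦ r^{-γ} f(r)` monotonic and
`∑_{n ≥ 1} f(ψ(3^n)) (3^n)^γ = ∞`, then `ℋ^f(W_𝒞(ψ)) = ℋ^f(𝒞)`. -/
theorem khintchine_divergence (f : ℝ → ℝ) (hf : IsDimFun f)
    (hfmono : MonotoneOn (fun r => r ^ (-gam) * f r) (Set.Ioi (0 : ℝ)) ∨
      AntitoneOn (fun r => r ^ (-gam) * f r) (Set.Ioi (0 : ℝ)))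
    (ψ : ℕ → ℝ) (hψ : ∀ n : ℕ, 1 ≤ n → ∃ r : ℤ, ψ n = (3 : ℝ) ^ (-r))
    (hdiv : ∑' n : ℕ, ENNReal.ofReal (f (ψ (n + 1)) * ((3 : ℝ) ^ (n + 1)) ^ gam) = ⊤) :
    hmeas f (Wc ψ) = hmeas f Cantor := by
  refine le_antisymm (hmeas_mono f fun h hh => hh.1) ?_
  choose R hR using fun n : ℕ => hψ (n + 1) (by omega)
  by_cases hlarge : ∃ m₀ : ℕ, ∀ n, m₀ ≤ n → (n : ℤ) + 1 < R n
  swap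
  · push Not at hlarge
    refine hmeas_mono f fun c hc => mem_Wc_of_coeff_eq_zero hR hc fun m => ?_
    obtain ⟨n, hn, hRn⟩ := hlarge m
    exact ⟨n, hn, fun j hj hjR => by omega⟩
  obtain ⟨m₀, hm₀⟩ := hlarge
  set φ : ℕ → ℝ≥0∞ := fun l => ENNReal.ofReal (f ((3 : ℝ) ^ (-(l : ℤ)))) with hφ
  have hanti : Antitone φ := fun k l h => ENNReal.ofReal_le_ofReal <|
    hf.mono (Set.mem_Ici.2 (by positivity)) (Set.mem_Ici.2 (by positivity))
      (antitone_three_zpow_neg h)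
  have hpos : ∀ l : ℕ, (3 : ℝ) ^ (-(l : ℤ)) ∈ Set.Ioi (0 : ℝ) := fun l =>
    Set.mem_Ioi.2 (by positivity)
  have hφdiv : ∑' n, 2 ^ n * φ (R n).toNat = ⊤ := by
    by_contra hne
    rw [← ENNReal.summable.sum_add_tsum_nat_add' (k := m₀)] at hdiv
    refine ENNReal.add_ne_top.2 ⟨ENNReal.sum_ne_top.2 fun _ _ => ENNReal.ofReal_ne_top, ?_⟩ hdiv
    refine ne_top_of_le_ne_top (ENNReal.mul_ne_top (ENNReal.ofNat_ne_top (n := 2)) hne) ?_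
    rw [← ENNReal.tsum_mul_left]
    refine le_trans (ENNReal.tsum_le_tsum fun n => le_of_eq ?_)
      (ENNReal.tsum_comp_le_tsum_of_injective (add_left_injective m₀) _)
    have hRn := hm₀ (n + m₀) (by omega)
    rw [hR, three_pow_rpow_gam, mul_comm, ENNReal.ofReal_mul (by positivity),
      ENNReal.ofReal_pow (by norm_num), ENNReal.ofReal_ofNat, hφ]
    simp only
    rw [Int.toNat_of_nonneg (by omega), pow_succ]
    ring
  rcases hfmono with hmon | hant
  · have hdec : Antitone fun l => 2 ^ l * φ l := by
      intro k l h
      simp only [hφ, ← ofReal_three_zpow_rpow_mul]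
      exact ENNReal.ofReal_le_ofReal (hmon (hpos l) (hpos k) (antitone_three_zpow_neg h))
    set L : ℝ≥0∞ := ⨅ l, 2 ^ l * φ l with hL
    have hupper : hmeas f Cantor ≤ L := by
      refine le_of_forall_gt_imp_ge_of_dense fun b hb => ?_
      obtain ⟨l, hl⟩ := iInf_lt_iff.1 hb
      exact hmeas_Cantor_le f b fun r₀ => ⟨max r₀ l, le_max_left _ _,
        (hdec (le_max_right r₀ l)).trans hl.le⟩
    rcases eq_or_ne L 0 with hL0 | hL0
    · exact hupper.trans (hL0.trans_le bot_le)
    have hpow : ∀ l : ℕ, (2 : ℝ≥0∞) ^ l * (2 ^ l)⁻¹ = 1 := fun l =>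
      ENNReal.mul_inv_cancel (by simp) (by simp)
    have hconst : ∀ l : ℕ, 2 ^ l * (L * (2 ^ l)⁻¹) = L := fun l => by
      rw [mul_left_comm, hpow, mul_one]
    refine hupper.trans ?_
    rw [← hconst 0]
    refine le_hmeas_Wc hR hm₀ (φ := fun l => L * (2 ^ l)⁻¹) (fun l => ?_) (fun k l h => ?_)
      (fun k l h => by simp only [hconst, le_refl]) ?_ 0
    · rw [← div_eq_mul_inv]
      refine ENNReal.div_le_of_le_mul' (iInf_le _ l)
    · simp only
      gcongr
      norm_num
    · have h1 : ∑' n, (2 : ℝ≥0∞) ^ n * (2 ^ (R n).toNat)⁻¹ = ⊤ := by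
        by_contra hne
        refine ENNReal.mul_ne_top (ENNReal.ofReal_ne_top : φ 0 ≠ ⊤) hne ?_
        rw [← top_le_iff, ← hφdiv, ← ENNReal.tsum_mul_left]
        refine ENNReal.tsum_le_tsum fun n => ?_
        rw [mul_left_comm]
        gcongr
        rw [← div_eq_mul_inv, ENNReal.le_div_iff_mul_le (by simp) (by simp), mul_comm]
        simpa only [pow_zero, one_mul] using hdec (Nat.zero_le (R n).toNat)
      simp_rw [mul_left_comm _ L]
      rw [ENNReal.tsum_mul_left, h1, ENNReal.mul_top hL0]
  · have hinc : Monotone fun l => 2 ^ l * φ l := by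
      intro k l h
      simp only [hφ, ← ofReal_three_zpow_rpow_mul]
      exact ENNReal.ofReal_le_ofReal (hant (hpos l) (hpos k) (antitone_three_zpow_neg h))
    refine hmeas_Cantor_le f _ fun r₀ => ⟨r₀, le_rfl, ?_⟩
    exact le_hmeas_Wc hR hm₀ (fun _ => le_rfl) hanti hinc hφdiv r₀
end
end
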